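/- Let G be a finite group and g ∈ G an element all of whose iterated commutators eventually vanish, i.e. g is a (left) Engel element: for every x ∈ G there is n with [x, g, …, g] = 1 (g repeated n times). Then g lies in the Fitting subgroup of G. -/

import Mathlib

/-- The commutator `[a,b] = a⁻¹b⁻¹ab`. -/
def cmt {G : Type*} [Group G] (a b : G) : G := a⁻¹ * b⁻¹ * a * b

/-- The left-normed iterated commutator `[x, ₙg]` with `n` copies of `g`. -/
def engel {G : Type*} [Group G] (x g : G) : ℕ → G
  | 0 => x
  | n + 1 => cmt (engel x g n) g

/-- The Fitting subgroup: the join of all nilpotent normal subgroups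
(for a finite group, the largest nilpotent normal subgroup). -/
def FittingSubgroup (G : Type*) [Group G] : Subgroup G :=
  ⨆ (H : Subgroup G) (_ : H.Normal ∧ Group.IsNilpotent H), H

open Subgroup
open scoped IsMulCommutative

/-- For each prime `p`, a nilpotent normal subgroup `H` of a finite group contains a `p`-subgroup
that is normal in the whole group and has index prime to `p` in `H`. -/
theorem exists_normal_isPGroup_not_dvd_relIndex {G : Type*} [Group G] [Finite G] (H : Subgroup G)
    [H.Normal] [Group.IsNilpotent H] (p : ℕ) [Fact p.Prime] :
    ∃ P : Subgroup G, P.Normal ∧ IsPGroup p P ∧ P ≤ H ∧ ¬ p ∣ P.relIndex H := by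
  obtain ⟨P⟩ : Nonempty (Sylow p H) := inferInstance
  have : (P : Subgroup H).Characteristic := P.characteristic_of_normal inferInstance
  refine ⟨(P : Subgroup H).map H.subtype, inferInstance, P.2.map _, map_subtype_le _, ?_⟩
  rw [relIndex, subgroupOf, comap_map_eq_self_of_injective H.subtype_injective]
  exact P.not_dvd_index

/-- **Fitting's theorem** for finite groups. -/
theorem isNilpotent_sup_of_normal {G : Type*} [Group G] [Finite G] (H K : Subgroup G)
    [H.Normal] [K.Normal] [Group.IsNilpotent H] [Group.IsNilpotent K] :
    Group.IsNilpotent (H ⊔ K : Subgroup G) := by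
  refine (Group.isNilpotent_of_finite_tfae.out 0 3 rfl rfl).mpr fun p hp P => ?_
  obtain ⟨A, hAn, hAp, hAH, hA⟩ := exists_normal_isPGroup_not_dvd_relIndex H p
  obtain ⟨B, hBn, hBp, hBK, hB⟩ := exists_normal_isPGroup_not_dvd_relIndex K p
  have hle : A ⊔ B ≤ H ⊔ K := sup_le_sup hAH hBK
  have hpg : IsPGroup p ((A ⊔ B).subgroupOf (H ⊔ K)) :=
    (hAp.to_sup_of_normal_left hBp).of_equiv (subgroupOfEquivOfLe hle).symm
  have hidx : ¬ p ∣ ((A ⊔ B).subgroupOf (H ⊔ K)).index := by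
    change ¬ p ∣ (A ⊔ B).relIndex (H ⊔ K)
    have hAB : A ⊔ B ≤ H ⊔ B := sup_le_sup_right hAH B
    have hHB : H ⊔ B ≤ H ⊔ K := sup_le_sup_left hBK H
    rw [← relIndex_mul_relIndex _ _ _ hAB hHB]
    refine Nat.Prime.not_dvd_mul hp.out (fun h => hA (h.trans ?_)) (fun h => hB (h.trans ?_))
    · have : H ⊔ B = H ⊔ (A ⊔ B) := by rw [← sup_assoc, sup_eq_left.mpr hAH]
      rw [this, relIndex_sup_right]
      exact relIndex_dvd_of_le_left _ le_sup_left
    · have : H ⊔ K = K ⊔ (H ⊔ B) := by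
        rw [sup_comm K, sup_assoc, sup_eq_right.mpr hBK]
      rw [this, relIndex_sup_right]
      exact relIndex_dvd_of_le_left _ le_sup_right
  have hQ : (hpg.toSylow hidx : Subgroup (H ⊔ K : Subgroup G)).Normal := by
    rw [IsPGroup.toSylow_coe]
    infer_instance
  have := Sylow.unique_of_normal _ hQ
  rwa [Subsingleton.elim P (hpg.toSylow hidx)]

theorem FittingSubgroup.normal_and_isNilpotent (G : Type*) [Group G] [Finite G] :
    (FittingSubgroup G).Normal ∧ Group.IsNilpotent (FittingSubgroup G) := by
  have hcl : SupClosed {H : Subgroup G | H.Normal ∧ Group.IsNilpotent H} := by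
    rintro H ⟨_, _⟩ K ⟨_, _⟩
    exact ⟨inferInstance, isNilpotent_sup_of_normal H K⟩
  exact hcl.biSup_mem (Set.toFinite {H : Subgroup G | H.Normal ∧ Group.IsNilpotent H})
    ⟨inferInstance, inferInstance⟩ fun _ h => h

theorem le_FittingSubgroup {G : Type*} [Group G] (H : Subgroup G) [hn : H.Normal]
    [hH : Group.IsNilpotent H] : H ≤ FittingSubgroup G :=
  le_iSup₂_of_le H ⟨hn, hH⟩ le_rfl

theorem isNilpotent_of_le {G : Type*} [Group G] {H K : Subgroup G} (hle : H ≤ K)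
    [Group.IsNilpotent K] : Group.IsNilpotent H :=
  Group.isNilpotent_congr (subgroupOfEquivOfLe hle) |>.mp inferInstance

theorem map_engel {G H : Type*} [Group G] [Group H] (f : G →* H) (x g : G) (n : ℕ) :
    f (engel x g n) = engel (f x) (f g) n := by
  induction n with
  | zero => rfl
  | succ n ih => simp [engel, cmt, ih]

/-- The elements normalizing a subgroup `V` also normalize the part of `V` in a
conjugation-invariant set `D`. -/
theorem normalizer_le_normalizer_inter {G : Type*} [Group G] {D : Set G}
    (hD : ∀ x, ∀ d ∈ D, x * d * x⁻¹ ∈ D) (V : Subgroup G) :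
    normalizer (V : Set G) ≤ normalizer (D ∩ V) := by
  intro x hx
  rw [mem_normalizer_iff] at hx
  refine fun d => and_congr ⟨hD x d, fun h => ?_⟩ (hx d)
  simpa [mul_assoc] using hD x⁻¹ _ h

/-- Normalizer growth in a nilpotent subgroup, relative to a conjugation-invariant set. -/
theorem exists_mem_normalizer_inter {G : Type*} [Group G] [Finite G] {D : Set G}
    (hD : ∀ x, ∀ d ∈ D, x * d * x⁻¹ ∈ D) {T U : Subgroup G} [Group.IsNilpotent U] (hTU : T ≤ U)
    (h : ¬ D ∩ U ⊆ T) : ∃ d ∈ D ∩ U, d ∉ T ∧ d ∈ normalizer (D ∩ T) := by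
  obtain ⟨V, hTV, hV⟩ := (Set.toFinite {V : Subgroup G | V ≤ U ∧ D ∩ V ⊆ T}).exists_le_maximal
    (a := T) ⟨hTU, Set.inter_subset_right⟩
  have hDV : D ∩ V = D ∩ T := Set.Subset.antisymm
    (Set.subset_inter Set.inter_subset_left hV.prop.2) (Set.inter_subset_inter_right D hTV)
  have hne : V.subgroupOf U < ⊤ := by
    refine lt_top_iff_ne_top.mpr fun htop => h ?_
    rw [subgroupOf_eq_top] at htop
    exact (Set.inter_subset_inter_right D htop).trans hV.prop.2
  obtain ⟨u, huN, huV⟩ := SetLike.exists_of_lt (Group.normalizerCondition_of_isNilpotent _ hne)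
  have hu : (u : G) ∈ normalizer (V : Set G) := by
    rw [mem_normalizer_iff] at huN ⊢
    intro v
    refine ⟨fun hv => (huN ⟨v, hV.prop.1 hv⟩).mp hv, fun hv => ?_⟩
    have hvU : v ∈ U := by
      simpa [mul_assoc] using U.mul_mem (U.mul_mem (U.inv_mem u.2) (hV.prop.1 hv)) u.2
    exact (huN ⟨v, hvU⟩).mpr hv
  have hW : ¬ D ∩ (normalizer (V : Set G) ⊓ U : Subgroup G) ⊆ (T : Set G) := fun hW =>
    huV (hV.le_of_ge ⟨inf_le_right, hW⟩ (le_inf le_normalizer hV.prop.1) ⟨hu, u.2⟩)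
  obtain ⟨d, ⟨hdD, hdN, hdU⟩, hdT⟩ := Set.not_subset.mp hW
  exact ⟨d, ⟨hdD, hdU⟩, hdT, hDV ▸ normalizer_le_normalizer_inter hD V hdN⟩

/-- Let `D` be a conjugation-invariant set that generates a nilpotent subgroup inside every proper
subgroup. If no nonempty part of `D` generating a nilpotent subgroup is normalized by `G`, then
maximal subgroups with a common element in `D` are equal. -/
theorem IsCoatom.eq_of_inter_nonempty {G : Type*} [Group G] [Finite G] {D : Set G}
    (hD : ∀ x, ∀ d ∈ D, x * d * x⁻¹ ∈ D)
    (hnil : ∀ X : Subgroup G, X ≠ ⊤ → Group.IsNilpotent (closure (D ∩ X)))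
    (hnorm : ∀ A ⊆ D, A.Nonempty → Group.IsNilpotent (closure A) → normalizer A ≠ ⊤)
    {X Y : Subgroup G} (hX : IsCoatom X) (hY : IsCoatom Y)
    (hXY : (D ∩ (X ⊓ Y : Subgroup G)).Nonempty) :
    X = Y := by
  induction hA : D ∩ (X ⊓ Y : Subgroup G) using WellFoundedGT.induction generalizing X Y with
  | ind A ih =>
  rw [hA] at hXY
  have hAD : A ⊆ D := hA ▸ Set.inter_subset_left
  have hAX : A ⊆ X := fun a ha => (hA ▸ ha : a ∈ D ∩ (X ⊓ Y : Subgroup G)).2.1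
  have hAY : A ⊆ Y := fun a ha => (hA ▸ ha : a ∈ D ∩ (X ⊓ Y : Subgroup G)).2.2
  have hDA : D ∩ closure A = A := by
    refine Set.Subset.antisymm ?_ (Set.subset_inter hAD subset_closure)
    rintro d ⟨hdD, hd⟩
    rw [← hA]
    exact ⟨hdD, (closure_le X).mpr hAX hd, (closure_le Y).mpr hAY hd⟩
  have hAN : closure A ≤ normalizer A := by
    have := le_normalizer.trans (normalizer_le_normalizer_inter hD (closure A))
    rwa [hDA] at this
  have hAnil : Group.IsNilpotent (closure A) :=
    have := hnil X hX.1
    isNilpotent_of_le (closure_mono (Set.subset_inter hAD hAX))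
  obtain hZ | ⟨Z, hZ, hNZ⟩ := eq_top_or_exists_le_coatom (normalizer A)
  · exact absurd hZ (hnorm A hAD hXY hAnil)
  suffices key : ∀ W : Subgroup G, IsCoatom W → A ⊆ W → Z = W from
    (key X hX hAX).symm.trans (key Y hY hAY)
  intro W hW hAW
  have hnW := hnil W hW.1
  by_cases hDW : D ∩ W ⊆ A
  · have hDW' : D ∩ W = A := hDW.antisymm (Set.subset_inter hAD hAW)
    have hWZ : W ≤ Z := by
      refine (le_normalizer.trans (normalizer_le_normalizer_inter hD W)).trans ?_
      rwa [hDW']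
    exact (hW.le_iff.mp hWZ).resolve_left hZ.1
  · have hUW : closure (D ∩ W) ≤ W := (closure_le W).mpr Set.inter_subset_right
    have hnot : ¬ D ∩ closure (D ∩ W) ⊆ (closure A : Set G) := fun hsub => hDW fun d hd =>
      hDA.subset ⟨hd.1, hsub ⟨hd.1, subset_closure hd⟩⟩
    obtain ⟨d, ⟨hdD, hdU⟩, hdA, hdN⟩ := exists_mem_normalizer_inter hD
      (closure_mono (Set.subset_inter hAD hAW)) hnot
    rw [hDA] at hdN
    have hlt : A ⊂ D ∩ (Z ⊓ W : Subgroup G) :=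
      (Set.ssubset_iff_of_subset fun a ha =>
        (⟨hAD ha, hNZ (hAN (subset_closure ha)), hAW ha⟩ : a ∈ D ∩ (Z ⊓ W : Subgroup G))).mpr
        ⟨d, ⟨hdD, hNZ hdN, hUW hdU⟩, fun h => hdA (subset_closure h)⟩
    exact ih _ hlt hZ hW (hXY.mono hlt.subset) rfl

/-- If the left Engel elements of every proper subgroup lie in its Fitting subgroup, then so do
those of the whole group. -/
theorem mem_FittingSubgroup_of_forall_subgroup {G : Type*} [Group G] [Finite G]
    (hsub : ∀ X : Subgroup G, X ≠ ⊤ → ∀ y : X, (∀ x : X, ∃ n, engel x y n = 1) →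
      y ∈ FittingSubgroup X)
    (g : G) (h : ∀ x : G, ∃ n, engel x g n = 1) : g ∈ FittingSubgroup G := by
  by_contra hg
  have hD : ∀ x, ∀ d ∈ conjugatesOf g, x * d * x⁻¹ ∈ conjugatesOf g := fun x d hd =>
    IsConj.trans hd (isConj_iff.mpr ⟨x, rfl⟩)
  have hDE : ∀ d ∈ conjugatesOf g, ∀ x, ∃ n, engel x d n = 1 := by
    intro d hd x
    obtain ⟨c, rfl⟩ := isConj_iff.mp hd
    obtain ⟨n, hn⟩ := h (c⁻¹ * x * c)
    refine ⟨n, ?_⟩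
    have := map_engel (MulAut.conj c).toMonoidHom (c⁻¹ * x * c) g n
    rw [hn, map_one] at this
    simpa [mul_assoc] using this.symm
  have hnil : ∀ X : Subgroup G, X ≠ ⊤ → Group.IsNilpotent (closure (conjugatesOf g ∩ X)) := by
    intro X hX
    have := (FittingSubgroup.normal_and_isNilpotent X).2
    have : Group.IsNilpotent ((FittingSubgroup X).map X.subtype) :=
      Group.isNilpotent_congr ((FittingSubgroup X).equivMapOfInjective _ X.subtype_injective)
        |>.mp this
    refine isNilpotent_of_le ((closure_le ((FittingSubgroup X).map X.subtype)).mpr ?_)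
    rintro d ⟨hd, hdX⟩
    refine ⟨⟨d, hdX⟩, hsub X hX _ fun x => ?_, rfl⟩
    obtain ⟨n, hn⟩ := hDE d hd x
    exact ⟨n, X.subtype_injective ((map_engel X.subtype x ⟨d, hdX⟩ n).trans hn)⟩
  have hnorm : ∀ A ⊆ conjugatesOf g, A.Nonempty → Group.IsNilpotent (closure A) →
      normalizer A ≠ ⊤ := by
    rintro A hA ⟨d, hd⟩ hAnil htop
    have hn : (closure A).Normal := normalizer_eq_top_iff.mp
      (top_le_iff.mp (htop ▸ normalizer_le_normalizer_closure A))
    obtain ⟨c, hc⟩ := isConj_iff.mp (hA hd)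
    have := hn.conj_mem d (subset_closure hd) c⁻¹
    rw [← hc] at this
    exact hg (le_FittingSubgroup (closure A) (by simpa [mul_assoc] using this))
  obtain hz | ⟨M, hM, hgM⟩ := eq_top_or_exists_le_coatom (zpowers g)
  · have : (zpowers g).Normal := hz ▸ inferInstance
    have : Group.IsNilpotent (zpowers g) :=
      CommGroup.isNilpotent (G := zpowers g)
    exact hg (le_FittingSubgroup (zpowers g) (mem_zpowers g))
  have hgM : g ∈ M := hgM (mem_zpowers g)
  have hgD : g ∈ conjugatesOf g := IsConj.refl g
  have hMN : normalizer (M : Set G) = M := by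
    refine (hM.le_iff.mp le_normalizer).resolve_left fun htop => ?_
    refine hnorm _ Set.inter_subset_left ⟨g, hgD, hgM⟩ (hnil M hM.1) (top_le_iff.mp ?_)
    exact htop ▸ normalizer_le_normalizer_inter hD M
  have hstep : ∀ x, cmt x g ∈ M → x ∈ M := by
    intro x hx
    have hy : x⁻¹ * g * x ∈ M := by
      have := M.mul_mem hgM (M.inv_mem hx)
      simpa [cmt, mul_assoc] using this
    let e := (MulAut.conj x).mapSubgroup
    have hgM' : g ∈ e M := ⟨_, hy, by simp [mul_assoc]⟩
    have heq : M = e M := IsCoatom.eq_of_inter_nonempty hD hnil hnorm hM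
      ((e.isCoatom_iff M).mpr hM) ⟨g, hgD, hgM, hgM'⟩
    rw [← hMN, mem_normalizer_iff_map_conj_eq]
    exact heq.symm
  refine hM.1 (eq_top_iff.mpr fun x _ => ?_)
  obtain ⟨n, hn⟩ := h x
  have hdesc : ∀ n, engel x g n ∈ M → x ∈ M := by
    intro n
    induction n with
    | zero => exact id
    | succ n ih => exact fun hn => ih (hstep _ hn)
  exact hdesc n (hn ▸ M.one_mem)

theorem mem_FittingSubgroup_of_card_eq (n : ℕ) : ∀ (G : Type*) [Group G] [Finite G] (g : G),
    Nat.card G = n → (∀ x : G, ∃ n, engel x g n = 1) → g ∈ FittingSubgroup G := by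
  induction n using Nat.strong_induction_on with
  | _ n ih =>
  rintro G _ _ g rfl h
  refine mem_FittingSubgroup_of_forall_subgroup (fun X hX y hy => ih _ ?_ X y rfl hy) g h
  exact (card_le_card_group X).lt_of_ne fun hc => hX (eq_top_of_card_eq X hc)

/-- Baer's theorem: a left Engel element of a finite group lies in the
Fitting subgroup. -/
theorem stmt14 {G : Type*} [Group G] [Finite G] (g : G)
    (h : ∀ x : G, ∃ n : ℕ, engel x g n = 1) :
    g ∈ FittingSubgroup G :=
  mem_FittingSubgroup_of_card_eq _ G g rfl h
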